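/- arXiv:math/0209340 — 2 statements merged into one kernel-verified Lean document; each statement's English description precedes it below -/
import Mathlib

section
/- For every n ≥ 1, the number of permutations of length n that avoid both generalized patterns 12-3 and 21-3 equals the number of involutions of length n. -/
/-- `π` avoids the generalized pattern 12-3: there are no positions `i` and `k`
with `i + 1 < k` and `π i < π (i+1) < π k`. -/
def Avoids12d3 {n : ℕ} (π : Equiv.Perm (Fin n)) : Prop :=
  ¬ ∃ i k : Fin n, ∃ h : (i : ℕ) + 1 < (k : ℕ),
      π i < π ⟨(i : ℕ) + 1, Nat.lt_trans h k.isLt⟩ ∧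
        π ⟨(i : ℕ) + 1, Nat.lt_trans h k.isLt⟩ < π k

/-- `π` avoids the generalized pattern 21-3: there are no positions `i` and `k`
with `i + 1 < k` and `π (i+1) < π i < π k`. -/
def Avoids21d3 {n : ℕ} (π : Equiv.Perm (Fin n)) : Prop :=
  ¬ ∃ i k : Fin n, ∃ h : (i : ℕ) + 1 < (k : ℕ),
      π ⟨(i : ℕ) + 1, Nat.lt_trans h k.isLt⟩ < π i ∧ π i < π k

namespace AvoidInv

variable {α : Type} [LinearOrder α]

def Good : List α → Prop
  | [] => True
  | [_] => True
  | a :: b :: l => (∀ c ∈ l, c < max a b) ∧ Good (b :: l)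

def A (s : Finset α) : Type := {l : List α // l.Nodup ∧ (∀ x, x ∈ l ↔ x ∈ s) ∧ Good l}

def J (s : Finset α) : Type := {f : Equiv.Perm α // (∀ x, f (f x) = x) ∧ ∀ x, x ∉ s → f x = x}

lemma good_tail {a : α} {l : List α} (h : Good (a :: l)) : Good l := by
  cases l with
  | nil => trivial
  | cons b l => exact h.2

lemma good_cons {m : α} {l : List α} (hm : ∀ c ∈ l, c < m) (h : Good l) : Good (m :: l) := by
  cases l with
  | nil => trivial
  | cons b l => exact ⟨fun c hc => lt_max_of_lt_left (hm c (by simp [hc])), h⟩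

lemma good_cons2 {a m : α} {l : List α} (hm : ∀ c ∈ l, c < m) (h : Good l) :
    Good (a :: m :: l) :=
  ⟨fun c hc => lt_max_of_lt_right (hm c hc), good_cons hm h⟩

abbrev Step (F : Finset α → Type) (s : Finset α) (m : α) : Type :=
  F (s.erase m) ⊕ Σ a : {a // a ∈ s.erase m}, F ((s.erase m).erase a.1)

def stepA (s : Finset α) (m : α) (hm : m ∈ s) (hx : ∀ x ∈ s, x ≤ m) : Step A s m → A s
  | .inl l => ⟨m :: l.1, by
      obtain ⟨l, h1, h2, h3⟩ := l
      refine ⟨?_, ?_, ?_⟩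
      · simp [h1, h2]
      · intro x
        simp only [List.mem_cons, h2, Finset.mem_erase]
        grind
      · apply good_cons _ h3
        intro c hc
        have := (h2 c).1 hc
        grind⟩
  | .inr ⟨a, l⟩ => ⟨a.1 :: m :: l.1, by
      obtain ⟨l, h1, h2, h3⟩ := l
      obtain ⟨a, ha⟩ := a
      refine ⟨?_, ?_, ?_⟩
      · simp only [List.nodup_cons, List.mem_cons, h2]
        grind
      · intro x
        simp only [List.mem_cons, h2, Finset.mem_erase]
        grind
      · apply good_cons2 _ h3
        intro c hc
        have := (h2 c).1 hc
        grind⟩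

lemma stepA_bij (s : Finset α) (m : α) (hm : m ∈ s) (hx : ∀ x ∈ s, x ≤ m) :
    Function.Bijective (stepA s m hm hx) := by
  constructor
  · rintro (⟨l, hl⟩ | ⟨⟨a, ha⟩, ⟨l, hl⟩⟩) (⟨l', hl'⟩ | ⟨⟨a', ha'⟩, ⟨l', hl'⟩⟩) h
    · have := congrArg Subtype.val h
      simp only [stepA, List.cons.injEq, true_and] at this
      subst this; rfl
    · have := congrArg Subtype.val h
      simp only [stepA, List.cons.injEq] at this
      exact absurd this.1.symm (Finset.ne_of_mem_erase ha')
    · have := congrArg Subtype.val h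
      simp only [stepA, List.cons.injEq] at this
      exact absurd this.1 (Finset.ne_of_mem_erase ha)
    · have := congrArg Subtype.val h
      simp only [stepA, List.cons.injEq, true_and] at this
      obtain ⟨rfl, rfl⟩ := this
      rfl
  · rintro ⟨l, h1, h2, h3⟩
    match l, h1, h2, h3 with
    | [], h1, h2, h3 => exact absurd ((h2 m).2 hm) (by simp)
    | x :: r, h1, h2, h3 =>
      by_cases hxm : x = m
      · subst hxm
        refine ⟨.inl ⟨r, (List.nodup_cons.1 h1).2, ?_, good_tail h3⟩, rfl⟩
        intro y
        have := h2 y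
        have := (List.nodup_cons.1 h1).1
        simp only [List.mem_cons] at *
        grind
      · match r, h1, h2, h3 with
        | [], h1, h2, h3 => exact absurd ((h2 m).2 hm) (by simpa using Ne.symm hxm)
        | y :: r, h1, h2, h3 =>
          have hxs := (h2 x).1 (by simp)
          have hys := (h2 y).1 (by simp)
          have hym : y = m := by
            by_contra hym
            have h4 : m ∈ r := by
              have := (h2 m).2 hm
              simp only [List.mem_cons] at this
              grind
            have h5 := h3.1 m h4
            exact absurd h5 (not_lt.2 (max_le (hx x hxs) (hx y hys)))
          subst hym
          refine ⟨.inr ⟨⟨x, Finset.mem_erase.2 ⟨hxm, hxs⟩⟩, ⟨r, ?_, ?_, good_tail h3.2⟩⟩, rfl⟩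
          · exact (List.nodup_cons.1 (List.nodup_cons.1 h1).2).2
          · intro z
            have := h2 z
            simp only [List.nodup_cons, List.mem_cons, Finset.mem_erase] at *
            grind

def stepJ (s : Finset α) (m : α) (hm : m ∈ s) : Step J s m → J s
  | .inl f => ⟨f.1, f.2.1, fun x hx => f.2.2 x (fun h => hx (Finset.mem_of_mem_erase h))⟩
  | .inr ⟨a, f⟩ => ⟨f.1 * Equiv.swap a.1 m, by
      obtain ⟨f, h1, h2⟩ := f
      obtain ⟨a, ha⟩ := a
      have ham := Finset.ne_of_mem_erase ha
      have has := Finset.mem_of_mem_erase ha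
      have fa : f a = a := h2 a (by simp)
      have fm : f m = m := h2 m (by simp)
      simp only [Equiv.Perm.mul_apply]
      constructor
      · intro x
        by_cases hxa : x = a
        · subst hxa; simp [fm, fa]
        by_cases hxm : x = m
        · subst hxm; simp [fm, fa]
        have e1 : f x ≠ a := fun h => hxa (by rw [← h1 x, h, fa])
        have e2 : f x ≠ m := fun h => hxm (by rw [← h1 x, h, fm])
        rw [Equiv.swap_apply_of_ne_of_ne hxa hxm, Equiv.swap_apply_of_ne_of_ne e1 e2, h1]
      · intro x hx
        rw [Equiv.swap_apply_of_ne_of_ne (by rintro rfl; exact hx has) (by rintro rfl; exact hx hm)]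
        exact h2 x (by grind)⟩

lemma stepJ_bij (s : Finset α) (m : α) (hm : m ∈ s) :
    Function.Bijective (stepJ s m hm) := by
  constructor
  · rintro (⟨l, hl⟩ | ⟨⟨a, ha⟩, ⟨l, hl⟩⟩) (⟨l', hl'⟩ | ⟨⟨a', ha'⟩, ⟨l', hl'⟩⟩) h
    · have := congrArg Subtype.val h
      simp only [stepJ] at this
      subst this; rfl
    · have := congrArg Subtype.val h
      simp only [stepJ] at this
      have e1 := hl.2 m (by simp)
      have e2 := hl'.2 a' (by simp)
      rw [this] at e1
      simp [e2] at e1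
      exact absurd e1 (Finset.ne_of_mem_erase ha')
    · have := congrArg Subtype.val h
      simp only [stepJ] at this
      have e1 := hl'.2 m (by simp)
      have e2 := hl.2 a (by simp)
      rw [← this] at e1
      simp [e2] at e1
      exact absurd e1 (Finset.ne_of_mem_erase ha)
    · have := congrArg Subtype.val h
      simp only [stepJ] at this
      have e1 := hl.2 a (by simp)
      have e2 := hl'.2 a' (by simp)
      have e3 : (l * Equiv.swap a m) m = (l' * Equiv.swap a' m) m := by rw [this]
      simp [e1, e2] at e3
      subst e3
      have := mul_right_cancel this
      subst this
      rfl
  · rintro ⟨f, h1, h2⟩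
    by_cases hfm : f m = m
    · refine ⟨.inl ⟨f, h1, ?_⟩, rfl⟩
      intro x hx
      by_cases hxm : x = m
      · rw [hxm, hfm]
      · exact h2 x (by grind)
    · have hs : f m ∈ s := by
        by_contra hc
        exact hfm (by have := h2 _ hc; rw [h1] at this; exact this.symm)
      refine ⟨.inr ⟨⟨f m, Finset.mem_erase.2 ⟨hfm, hs⟩⟩, ⟨f * Equiv.swap (f m) m, ?_, ?_⟩⟩, ?_⟩
      · intro x
        simp only [Equiv.Perm.mul_apply]
        by_cases hxa : x = f m
        · subst hxa; simp
        by_cases hxm : x = m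
        · subst hxm; simp [h1]
        have e1 : f x ≠ f m := fun h => hxm (f.injective h)
        have e2 : f x ≠ m := fun h => hxa (by rw [← h1 x, h])
        rw [Equiv.swap_apply_of_ne_of_ne hxa hxm, Equiv.swap_apply_of_ne_of_ne e1 e2, h1]
      · intro x hx
        simp only [Equiv.Perm.mul_apply]
        by_cases hxa : x = f m
        · subst hxa; simp
        by_cases hxm : x = m
        · subst hxm; simp [h1]
        rw [Equiv.swap_apply_of_ne_of_ne hxa hxm]
        exact h2 x (by grind)
      · apply Subtype.ext
        simp [stepJ, mul_assoc]

lemma main (k : ℕ) : ∀ s : Finset α, s.card = k → Nonempty (A s ≃ J s) := by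
  induction k using Nat.strong_induction_on with
  | _ k ih =>
    intro s hs
    rcases s.eq_empty_or_nonempty with rfl | hne
    · refine ⟨⟨fun _ => ⟨1, by simp, by simp⟩, fun _ => ⟨[], by simp, by simp, trivial⟩, ?_, ?_⟩⟩
      · rintro ⟨l, h1, h2, h3⟩
        apply Subtype.ext
        exact (List.eq_nil_iff_forall_not_mem.2 (fun a ha => by simpa using (h2 a).1 ha)).symm
      · rintro ⟨f, h1, h2⟩
        apply Subtype.ext
        ext x
        exact (h2 x (by simp)).symm
    · have hm := s.max'_mem hne
      have hx : ∀ x ∈ s, x ≤ s.max' hne := fun x h => s.le_max' x h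
      generalize s.max' hne = m at hm hx
      have c1 : (s.erase m).card < s.card := Finset.card_erase_lt_of_mem hm
      obtain ⟨e0⟩ := ih _ (hs ▸ c1) (s.erase m) rfl
      have e1 : ∀ a : {a // a ∈ s.erase m},
          Nonempty (A ((s.erase m).erase a.1) ≃ J ((s.erase m).erase a.1)) := fun a =>
        ih _ (hs ▸ (Finset.card_erase_lt_of_mem a.2).trans c1) _ rfl
      replace e1 := fun a => (e1 a).some
      exact ⟨(Equiv.ofBijective _ (stepA_bij s m hm hx)).symm.trans
        ((Equiv.sumCongr e0 (Equiv.sigmaCongrRight e1)).trans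
          (Equiv.ofBijective _ (stepJ_bij s m hm)))⟩

lemma good_iff (l : List α) : Good l ↔ ∀ i k, i + 1 < k → ∀ (hk : k < l.length)
    (hi : i < l.length) (hi' : i + 1 < l.length), l[k] < max l[i] l[i+1] := by
  induction l with
  | nil => simp [Good]
  | cons a l ih =>
    cases l with
    | nil => simp [Good]
    | cons b l =>
      rw [Good, ih]
      constructor
      · rintro ⟨h1, h2⟩ i k hik hk hi hi'
        obtain _ | _ | k := k
        · omega
        · omega
        · cases i with
          | zero => exact h1 _ (List.getElem_mem _)
          | succ i =>
            exact h2 i (k+1) (by omega) (by simpa using hk) (by simpa using hi) (by simpa using hi')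
      · intro h
        constructor
        · intro c hc
          obtain ⟨k, hk, rfl⟩ := List.getElem_of_mem hc
          exact h 0 (k+2) (by omega) (by simpa using hk) (by simp) (by simp)
        · intro i k hik hk hi hi'
          exact h (i+1) (k+1) (by omega) (by simpa using hk) (by simpa using hi) (by simpa using hi')

lemma avoid_iff {n : ℕ} (π : Equiv.Perm (Fin n)) :
    (Avoids12d3 π ∧ Avoids21d3 π) ↔ Good (List.ofFn π) := by
  rw [good_iff]
  constructor
  · rintro ⟨h1, h2⟩ i k hik hk hi hi'
    simp only [List.length_ofFn] at hk hi hi'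
    simp only [List.getElem_ofFn]
    by_contra hc
    rw [not_lt, max_le_iff] at hc
    have n1 : π ⟨i, hi⟩ ≠ π ⟨k, hk⟩ := fun h => by
      have := π.injective h; simp at this; omega
    have n2 : π ⟨i+1, hi'⟩ ≠ π ⟨k, hk⟩ := fun h => by
      have := π.injective h; simp at this; omega
    have n3 : π ⟨i, hi⟩ ≠ π ⟨i+1, hi'⟩ := fun h => by
      have := π.injective h; simp at this
    rcases lt_or_gt_of_ne n3 with h | h
    · exact h1 ⟨⟨i, hi⟩, ⟨k, hk⟩, hik, h, lt_of_le_of_ne hc.2 n2⟩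
    · exact h2 ⟨⟨i, hi⟩, ⟨k, hk⟩, hik, h, lt_of_le_of_ne hc.1 n1⟩
  · intro h
    constructor
    · rintro ⟨i, k, hik, h1, h2⟩
      have := h i k hik (by simp) (by simp) (by simp; omega)
      simp only [List.getElem_ofFn] at this
      exact absurd this (not_lt.2 (max_le (h1.trans h2).le h2.le))
    · rintro ⟨i, k, hik, h1, h2⟩
      have := h i k hik (by simp) (by simp) (by simp; omega)
      simp only [List.getElem_ofFn] at this
      exact absurd this (not_lt.2 (max_le h2.le (h1.trans h2).le))

def toA {n : ℕ} (π : {π : Equiv.Perm (Fin n) // Avoids12d3 π ∧ Avoids21d3 π}) :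
    A (Finset.univ : Finset (Fin n)) :=
  ⟨List.ofFn π.1, List.nodup_ofFn.2 π.1.injective, fun x => by
    simpa [List.mem_ofFn] using π.1.surjective x, (avoid_iff _).1 π.2⟩

lemma toA_bij {n : ℕ} : Function.Bijective (toA (n := n)) := by
  constructor
  · intro p q h
    have := List.ofFn_injective (congrArg Subtype.val h)
    exact Subtype.ext (Equiv.coe_fn_injective this)
  · rintro ⟨l, h1, h2, h3⟩
    have hl : l.length = n := by
      have e : l.toFinset = Finset.univ := by ext x; simp [h2]
      rw [← List.toFinset_card_of_nodup h1, e]; simp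
    have hinj : Function.Injective (fun i : Fin n => l[i.1]'(by omega)) := by
      intro i j h
      exact Fin.ext ((List.Nodup.getElem_inj_iff h1).1 h)
    have e : List.ofFn (fun i : Fin n => l[i.1]'(by omega)) = l := by
      apply List.ext_getElem
      · simp [hl]
      · intro i _ _; simp
    refine ⟨⟨Equiv.ofBijective _ (Finite.injective_iff_bijective.1 hinj), ?_⟩, ?_⟩
    · rw [avoid_iff, Equiv.coe_ofBijective, e]; exact h3
    · exact Subtype.ext e

end AvoidInv

theorem avoid12d3_21d3_eq_involutions (n : ℕ) (hn : 1 ≤ n) :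
    Nat.card {π : Equiv.Perm (Fin n) // Avoids12d3 π ∧ Avoids21d3 π}
      = Nat.card {σ : Equiv.Perm (Fin n) // σ * σ = 1} := by
  obtain ⟨e⟩ := AvoidInv.main _ (Finset.univ : Finset (Fin n)) rfl
  refine Nat.card_congr (((Equiv.ofBijective _ AvoidInv.toA_bij).trans e).trans
    (Equiv.subtypeEquivRight fun f => ?_))
  simp [Equiv.ext_iff]
end

section
/- For every n ≥ 3, the number of permutations of length n that contain exactly one occurrence of the generalized pattern 12-3 and begin with the pattern 123 (i.e., π_1 < π_2 < π_3) equals (n-2)·B_{n-3}, where B_m is the m-th Bell number. -/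
/-- The `m`-th Bell number: the number of partitions of a set of `m` elements
into nonempty blocks. -/
noncomputable def bell (m : ℕ) : ℕ :=
  Nat.card (Finpartition (Finset.univ : Finset (Fin m)))

/-- `π` begins with the pattern `123`: it has length at least 3 and
`π 1 < π 2 < π 3`. -/
def BeginsInc123 {n : ℕ} (π : Equiv.Perm (Fin n)) : Prop :=
  ∃ h : 2 < n, π ⟨0, by omega⟩ < π ⟨1, by omega⟩ ∧ π ⟨1, by omega⟩ < π ⟨2, h⟩

theorem bell_of_rec {α : Type*} [DecidableEq α] (f : Finset α → ℕ) (h0 : f ∅ = 1)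
    (hs : ∀ s : Finset α, s.Nonempty → ∃ a ∈ s,
      f s = ∑ t ∈ (s.erase a).powerset, f ((s.erase a) \ t)) (s : Finset α) :
    f s = Nat.bell s.card := by
  induction s using Finset.strongInduction with
  | H s ih =>
    rcases s.eq_empty_or_nonempty with rfl | hne
    · simp [h0]
    · obtain ⟨a, ha, h⟩ := hs s hne
      have hc : s.card = (s.erase a).card + 1 := (Finset.card_erase_add_one ha).symm
      rw [h, hc, Nat.bell_succ, ← Nat.range_succ_eq_Iic]
      have : ∀ t ∈ (s.erase a).powerset,
          f ((s.erase a) \ t) = Nat.bell ((s.erase a).card - t.card) := by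
        intro t ht
        rw [ih, Finset.card_sdiff_of_subset (Finset.mem_powerset.1 ht)]
        exact lt_of_le_of_lt Finset.sdiff_subset (Finset.erase_ssubset ha)
      rw [Finset.sum_congr rfl this,
        Finset.sum_powerset_apply_card (fun k => Nat.bell ((s.erase a).card - k))]
      simp

theorem card_finpartition {α : Type*} [DecidableEq α] (s : Finset α) :
    Nat.card (Finpartition s) = Nat.bell s.card := by
  refine bell_of_rec (fun s => Nat.card (Finpartition s)) ?_ ?_ s
  · exact Nat.card_unique (α := Finpartition (⊥ : Finset α))
  · rintro s ⟨a, ha⟩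
    refine ⟨a, ha, ?_⟩
    have e1 : ∀ t : Finset α, insert a t ≠ ⊥ := fun t => Finset.insert_ne_empty a t
    have e2 : ∀ t : Finset α, Disjoint ((s.erase a) \ t) (insert a t) := by
      intro t
      rw [Finset.disjoint_left]
      grind
    have e3 : ∀ t ∈ (s.erase a).powerset, ((s.erase a) \ t) ⊔ (insert a t) = s := by
      intro t ht
      rw [Finset.mem_powerset] at ht
      ext x
      simp only [Finset.sup_eq_union]
      grind
    let F : (Σ t : (s.erase a).powerset, Finpartition ((s.erase a) \ (t : Finset α))) →
        Finpartition s := fun x => x.2.extend (e1 x.1) (e2 x.1) (e3 x.1 x.1.2)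
    have hF : Function.Bijective F := by
      constructor
      · rintro ⟨⟨t, ht⟩, Q⟩ ⟨⟨t', ht'⟩, Q'⟩ h
        have hp : insert (insert a t) Q.parts = insert (insert a t') Q'.parts :=
          congrArg Finpartition.parts h
        rw [Finset.mem_powerset] at ht ht'
        have hat : a ∉ t := fun h => by simpa using ht h
        have hat' : a ∉ t' := fun h => by simpa using ht' h
        have hQ : ∀ p ∈ Q.parts, a ∉ p := fun p hp h => by simpa using Q.le hp h
        have hQ' : ∀ p ∈ Q'.parts, a ∉ p := fun p hp h => by simpa using Q'.le hp h
        have h1 : insert a t = insert a t' := by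
          have : insert a t ∈ insert (insert a t') Q'.parts := hp ▸ Finset.mem_insert_self _ _
          rcases Finset.mem_insert.1 this with h | h
          · exact h
          · exact absurd (Finset.mem_insert_self _ _) (hQ' _ h)
        have h2 : t = t' := by
          rw [← Finset.erase_insert hat, h1, Finset.erase_insert hat']
        subst h2
        have h3 : Q = Q' := by
          ext1
          rw [← Finset.erase_insert (s := Q.parts) (a := insert a t)
            (fun h => hQ _ h (Finset.mem_insert_self _ _)), hp, Finset.erase_insert
            (fun h => hQ' _ h (Finset.mem_insert_self _ _))]
        subst h3
        rfl
      · intro P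
        obtain ⟨p, hp, hap⟩ := P.exists_mem ha
        have hps := P.le hp
        have ht : p.erase a ∈ (s.erase a).powerset :=
          Finset.mem_powerset.2 (Finset.erase_subset_erase a hps)
        have hsup : (P.parts.erase p).sup id = (s.erase a) \ (p.erase a) := by
          ext x
          simp only [Finset.mem_sup, Finset.mem_erase, id, Finset.mem_sdiff]
          constructor
          · rintro ⟨q, ⟨hqp, hq⟩, hx⟩
            have hd := Finset.disjoint_left.1 (P.disjoint hq hp hqp)
            have := hd hx
            exact ⟨⟨fun h => this (h ▸ hap), P.le hq hx⟩, fun h => this h.2⟩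
          · rintro ⟨⟨hxa, hx⟩, h⟩
            obtain ⟨q, hq, hxq⟩ := P.exists_mem hx
            refine ⟨q, ⟨?_, hq⟩, hxq⟩
            rintro rfl
            exact h ⟨hxa, hxq⟩
        refine ⟨⟨⟨p.erase a, ht⟩, P.ofSubset (Finset.erase_subset p _) hsup⟩, ?_⟩
        ext1
        change insert (insert a (p.erase a)) (P.parts.erase p) = P.parts
        rw [Finset.insert_erase hap, Finset.insert_erase hp]
    change Nat.card (Finpartition s) = _
    rw [← Nat.card_eq_of_bijective F hF, Nat.card_sigma]
    exact Finset.sum_coe_sort (s.erase a).powerset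
      (fun t => Nat.card (Finpartition ((s.erase a) \ t)))

/-- Lists avoiding 12-3. -/
def Av {α : Type*} [LinearOrder α] : List α → Prop
  | [] => True
  | a :: l => (∀ b r, l = b :: r → a < b → ∀ c ∈ r, ¬ b < c) ∧ Av l

theorem av_iff {α : Type*} [LinearOrder α] (l : List α) :
    Av l ↔ ∀ (i k : ℕ) (h : i + 1 < k) (hk : k < l.length),
      ¬ (l[i] < l[i+1] ∧ l[i+1] < l[k]) := by
  induction l with
  | nil => simp [Av]
  | cons a l ih =>
    rw [Av, ih]
    constructor
    · rintro ⟨h1, h2⟩ i k h hk ⟨h3, h4⟩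
      obtain ⟨k, rfl⟩ : ∃ k', k = k' + 2 := ⟨k - 2, by omega⟩
      cases i with
      | zero =>
        cases l with
        | nil => simp at hk
        | cons b r =>
          simp only [List.getElem_cons_succ, List.getElem_cons_zero] at h3 h4
          exact h1 b r rfl h3 _ (List.getElem_mem _) h4
      | succ i =>
        simp only [List.getElem_cons_succ] at h3 h4
        exact h2 i (k+1) (by omega) (by simp at hk; omega) ⟨h3, h4⟩
    · intro H
      constructor
      · rintro b r rfl hab c hc hbc
        obtain ⟨j, hj, rfl⟩ := List.mem_iff_getElem.1 hc
        exact H 0 (j+2) (by omega) (by simpa using hj) ⟨by simpa using hab, by simpa using hbc⟩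
      · intro i k h hk h'
        exact H (i+1) (k+1) (by omega) (by simpa using hk) (by simpa using h')

theorem av_split {α : Type*} [LinearOrder α] (M : α) (L R : List α)
    (hL : ∀ x ∈ L, x < M) (hR : ∀ x ∈ R, x < M) :
    Av (L ++ M :: R) ↔ L.Pairwise (fun a b => b ≤ a) ∧ Av R := by
  induction L with
  | nil =>
    simp only [List.nil_append, Av, List.Pairwise.nil, true_and, and_iff_right_iff_imp]
    rintro - b r rfl h
    exact absurd h (hR b (by simp)).not_gt
  | cons a L ih =>
    have ih := ih (fun x hx => hL x (List.mem_cons_of_mem _ hx))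
    rw [List.cons_append, Av, ih, List.pairwise_cons, and_assoc, ← and_assoc,  ← and_assoc]
    refine and_congr_left fun _ => ?_
    refine and_congr_left fun hp => ?_
    cases L with
    | nil =>
      simp only [List.nil_append, List.cons.injEq, List.not_mem_nil, false_imp_iff, implies_true,
        iff_true]
      rintro b r ⟨rfl, rfl⟩ - c hc
      exact (hR c hc).not_gt
    | cons b L =>
      have hbM : b < M := hL b (by simp)
      constructor
      · intro h
        have hba : b ≤ a := by
          by_contra hab
          exact h b _ rfl (not_le.1 hab) M (by simp) hbM
        intro x hx
        rcases List.mem_cons.1 hx with rfl | hx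
        · exact hba
        · exact ((List.pairwise_cons.1 hp).1 x hx).trans hba
      · rintro h b' r hbr hab
        simp only [List.cons_append, List.cons.injEq] at hbr
        rw [← hbr.1] at hab
        exact absurd hab (h b (by simp)).not_gt

/-- Avoiding arrangements of a finite set. -/
def AvS {α : Type*} [LinearOrder α] (s : Finset α) : Type _ :=
  {l : List α // l.Nodup ∧ (∀ x, x ∈ l ↔ x ∈ s) ∧ Av l}

instance {α : Type*} [LinearOrder α] [Fintype α] (s : Finset α) : Finite (AvS s) :=
  Finite.of_injective (β := {l : List α // l.Nodup}) (fun l => ⟨l.1, l.2.1⟩) (by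
    intro x y h
    exact Subtype.ext (Subtype.mk.inj h))

theorem card_avS {α : Type*} [LinearOrder α] [Fintype α] (s : Finset α) :
    Nat.card (AvS s) = Nat.bell s.card := by
  refine bell_of_rec (fun s => Nat.card (AvS s)) ?_ ?_ s
  · rw [Nat.card_eq_one_iff_exists]
    refine ⟨⟨[], by simp [Av]⟩, ?_⟩
    rintro ⟨l, h1, h2, h3⟩
    apply Subtype.ext
    exact List.eq_nil_iff_forall_not_mem.2 (fun x hx => by simpa using (h2 x).1 hx)
  · intro s hne
    obtain ⟨M, hM, hmax⟩ : ∃ M ∈ s, ∀ x ∈ s, x ≤ M := ⟨s.max' hne, s.max'_mem hne, s.le_max'⟩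
    have hlt : ∀ x ∈ s.erase M, x < M := fun x hx =>
      lt_of_le_of_ne (hmax x (Finset.mem_of_mem_erase hx)) (Finset.ne_of_mem_erase hx)
    refine ⟨M, hM, ?_⟩
    let F : (Σ t : (s.erase M).powerset, AvS ((s.erase M) \ (t : Finset α))) → AvS s :=
      fun x => ⟨(x.1 : Finset α).sort (fun a b => b ≤ a) ++ M :: x.2.1, by
        obtain ⟨⟨t, ht⟩, ⟨R, h1, h2, h3⟩⟩ := x
        rw [Finset.mem_powerset] at ht
        dsimp only
        refine ⟨?_, ?_, ?_⟩
        · rw [List.nodup_append]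
          refine ⟨Finset.sort_nodup _ _, List.nodup_cons.2 ⟨?_, h1⟩, ?_⟩
          · rw [h2]; simp
          · intro a ha b hb
            rw [Finset.mem_sort] at ha
            rw [List.mem_cons, h2] at hb
            have := ht ha
            grind
        · intro x
          rw [List.mem_append, Finset.mem_sort, List.mem_cons, h2]
          have := @ht x
          grind
        · rw [av_split]
          · exact ⟨Finset.pairwise_sort _ _, h3⟩
          · intro x hx
            exact hlt x (ht ((Finset.mem_sort _).1 hx))
          · intro x hx
            exact hlt x (Finset.mem_sdiff.1 ((h2 x).1 hx)).1⟩
    have hF : Function.Bijective F := by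
      constructor
      · rintro ⟨⟨t, ht⟩, ⟨R, h1, h2, h3⟩⟩ ⟨⟨t', ht'⟩, ⟨R', h1', h2', h3'⟩⟩ h
        have h : t.sort (fun a b => b ≤ a) ++ M :: R = t'.sort (fun a b => b ≤ a) ++ M :: R' :=
          congrArg Subtype.val h
        rw [Finset.mem_powerset] at ht ht'
        have hMt : M ∉ t.sort (fun a b => b ≤ a) := by
          rw [Finset.mem_sort]; exact fun h => by simpa using ht h
        have hMt' : M ∉ R := by
          rw [h2]; simp
        have hMR : M ∉ R' := by
          rw [h2']; simp
        have hMt'' : M ∉ t'.sort (fun a b => b ≤ a) := by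
          rw [Finset.mem_sort]; exact fun h => by simpa using ht' h
        obtain ⟨e1, e2⟩ : t.sort (fun a b => b ≤ a) = t'.sort (fun a b => b ≤ a) ∧ R = R' := by
          rcases List.append_eq_append_iff.1 h with ⟨w, h4, h5⟩ | ⟨w, h4, h5⟩
          · cases w with
            | nil => simp_all
            | cons c w =>
              simp only [List.cons_append, List.cons.injEq] at h5
              rw [h4, ← h5.1] at hMt''
              simp at hMt''
          · cases w with
            | nil => simp_all
            | cons c w =>
              simp only [List.cons_append, List.cons.injEq] at h5
              rw [h4, ← h5.1] at hMt
              simp at hMt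
        have e3 : t = t' := by
          rw [← Finset.sort_toFinset t (fun a b => b ≤ a), e1, Finset.sort_toFinset]
        subst e3 e2
        rfl
      · rintro ⟨l, h1, h2, h3⟩
        obtain ⟨L, R, rfl⟩ := List.append_of_mem ((h2 M).2 hM)
        rw [List.nodup_append, List.nodup_cons] at h1
        obtain ⟨hL, ⟨hMR, hR⟩, hd⟩ := h1
        have hML : M ∉ L := fun h => hd M h M (by simp) rfl
        have hLs : ∀ x ∈ L, x ∈ s.erase M := fun x hx => Finset.mem_erase.2
          ⟨fun h => hML (h ▸ hx), (h2 x).1 (by simp [hx])⟩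
        have hRs : ∀ x ∈ R, x ∈ s.erase M := fun x hx => Finset.mem_erase.2
          ⟨fun h => hMR (h ▸ hx), (h2 x).1 (by simp [hx])⟩
        rw [av_split M L R (fun x hx => hlt x (hLs x hx)) (fun x hx => hlt x (hRs x hx))] at h3
        refine ⟨⟨⟨L.toFinset, Finset.mem_powerset.2 fun x hx => hLs x (List.mem_toFinset.1 hx)⟩,
          ⟨R, hR, ?_, h3.2⟩⟩, ?_⟩
        · intro x
          have := h2 x
          have := hLs x
          have := hRs x
          have := hd x
          simp only [Finset.mem_sdiff, List.mem_toFinset, Finset.mem_erase, List.mem_append,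
            List.mem_cons] at *
          grind
        · apply Subtype.ext
          change L.toFinset.sort (fun a b => b ≤ a) ++ M :: R = L ++ M :: R
          rw [(List.toFinset_sort (fun a b => b ≤ a) hL).2 h3.1]
    change Nat.card (AvS s) = _
    rw [← Nat.card_eq_of_bijective F hF, Nat.card_sigma]
    exact Finset.sum_coe_sort (s.erase M).powerset
      (fun t => Nat.card (AvS ((s.erase M) \ t)))

theorem cond_iff (m : ℕ) (π : Equiv.Perm (Fin (m+3))) :
    ((∃! p : Fin (m+3) × Fin (m+3), ∃ h : (p.1 : ℕ) + 1 < (p.2 : ℕ),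
        π p.1 < π ⟨(p.1 : ℕ) + 1, Nat.lt_trans h p.2.isLt⟩ ∧
          π ⟨(p.1 : ℕ) + 1, Nat.lt_trans h p.2.isLt⟩ < π p.2) ∧
      BeginsInc123 π) ↔
    (π ⟨1, by omega⟩ = ⟨m+1, by omega⟩ ∧ π ⟨2, by omega⟩ = ⟨m+2, by omega⟩ ∧
      Av (List.ofFn fun i : Fin m => π ⟨i + 3, by omega⟩)) := by
  rw [av_iff]
  simp only [List.length_ofFn, List.getElem_ofFn]
  constructor
  · have z0 : 0 < m + 3 := by omega
    have z2 : 2 < m + 3 := by omega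
    rintro ⟨⟨p, hp, hu⟩, h3, h01, h12⟩
    have h0 : (⟨0, z0⟩, ⟨2, z2⟩) = p := hu _ ⟨by simp, h01, h12⟩
    subst h0
    have hle : ∀ j : Fin (m+3), j ≠ ⟨2, by omega⟩ → π j ≤ π ⟨1, by omega⟩ := by
      intro j hj
      by_contra hlt
      rw [not_le] at hlt
      have hj0 : j ≠ ⟨0, by omega⟩ := by rintro rfl; exact absurd h01 hlt.not_gt
      have hj1 : j ≠ ⟨1, by omega⟩ := by intro h; rw [h] at hlt; exact lt_irrefl _ hlt
      have hjj : 0 + 1 < (j : ℕ) := by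
        simp only [ne_eq, Fin.ext_iff] at hj0 hj1
        omega
      have := hu (⟨0, by omega⟩, j) ⟨hjj, h01, hlt⟩
      exact hj (congrArg Prod.snd this)
    have e2 : π ⟨2, by omega⟩ = ⟨m+2, by omega⟩ := by
      obtain ⟨j, hj⟩ := π.surjective ⟨m+2, by omega⟩
      by_cases h : j = ⟨2, by omega⟩
      · rw [← h, hj]
      · have := hle j h
        rw [hj] at this
        simp only [Fin.lt_def, Fin.le_def] at this h12
        omega
    have e1 : π ⟨1, by omega⟩ = ⟨m+1, by omega⟩ := by
      obtain ⟨j, hj⟩ := π.surjective ⟨m+1, by omega⟩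
      have h : j ≠ ⟨2, by omega⟩ := by
        rintro rfl
        rw [e2] at hj
        simp at hj
      have := hle j h
      rw [hj] at this
      rw [e2] at h12
      simp only [Fin.lt_def, Fin.le_def] at this h12
      apply Fin.ext
      dsimp only
      omega
    refine ⟨e1, e2, ?_⟩
    rintro i k h hk ⟨ha, hb⟩
    have := hu (⟨i+3, by omega⟩, ⟨k+3, by omega⟩) ⟨by dsimp only; omega, by
      have : i + 1 + 3 = i + 3 + 1 := by omega
      simp only [this] at ha hb
      exact ⟨ha, hb⟩⟩
    simp at this
  · rintro ⟨e1, e2, hav⟩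
    have hne : ∀ j : Fin (m+3), j ≠ ⟨2, by omega⟩ → π j ≤ ⟨m+1, by omega⟩ := by
      intro j hj
      have : π j ≠ π ⟨2, by omega⟩ := fun h => hj (π.injective h)
      rw [e2] at this
      simp only [ne_eq, Fin.ext_iff, Fin.le_def] at this ⊢
      omega
    have h01 : π ⟨0, by omega⟩ < π ⟨1, by omega⟩ := by
      refine lt_of_le_of_ne ?_ (fun h => by simpa using π.injective h)
      rw [e1]
      exact hne _ (by simp)
    have h12 : π ⟨1, by omega⟩ < π ⟨2, by omega⟩ := by
      rw [e1, e2]; simp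
    refine ⟨⟨(⟨0, by omega⟩, ⟨2, by omega⟩), ⟨by simp, h01, h12⟩, ?_⟩, by omega, h01, h12⟩
    rintro ⟨⟨i, hi⟩, ⟨k, hk⟩⟩ ⟨h, ha, hb⟩
    dsimp only at h ha hb
    have hb' := hb
    match i, hi, h, ha, hb with
    | 0, hi, h, ha, hb =>
      by_cases hk2 : k = 2
      · subst hk2; rfl
      · have := hne ⟨k, hk⟩ (by simpa using hk2)
        rw [← e1] at this
        exact absurd hb this.not_gt
    | 1, hi, h, ha, hb =>
      have : π ⟨1 + 1, by omega⟩ = ⟨m+2, by omega⟩ := e2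
      rw [this, Fin.lt_def] at hb
      dsimp only at hb
      omega
    | 2, hi, h, ha, hb =>
      rw [e2, Fin.lt_def] at ha
      dsimp only at ha
      omega
    | i + 3, hi, h, ha, hb =>
      obtain ⟨k, rfl⟩ : ∃ k', k = k' + 3 := ⟨k - 3, by omega⟩
      refine absurd ?_ (hav i k (by omega) (by omega))
      have : i + 1 + 3 = i + 3 + 1 := by omega
      simp only [this]
      exact ⟨ha, hb⟩

theorem exists_perm (n : ℕ) (l : List (Fin n)) (h : l.Nodup) (hl : l.length = n) :
    ∃ π : Equiv.Perm (Fin n), List.ofFn π = l := by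
  let f : Fin n → Fin n := fun i => l[(i : ℕ)]
  have hf : Function.Injective f := by
    intro i j hij
    exact Fin.ext ((List.Nodup.getElem_inj_iff h).1 hij)
  refine ⟨Equiv.ofBijective f (Finite.injective_iff_bijective.1 hf), ?_⟩
  apply List.ext_getElem
  · simp [hl]
  · intro i h1 h2
    simp [f]

theorem main_count (m : ℕ) : Nat.card {π : Equiv.Perm (Fin (m+3)) //
    π ⟨1, by omega⟩ = ⟨m+1, by omega⟩ ∧ π ⟨2, by omega⟩ = ⟨m+2, by omega⟩ ∧
      Av (List.ofFn fun i : Fin m => π ⟨i + 3, by omega⟩)} = (m+1) * Nat.bell m := by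
  let p : Fin (m+3) := ⟨m+1, by omega⟩
  let q : Fin (m+3) := ⟨m+2, by omega⟩
  let T : Fin (m+1) → Finset (Fin (m+3)) := fun a => Finset.univ \ {⟨a, by omega⟩, p, q}
  have hofn : ∀ π : Equiv.Perm (Fin (m+3)), List.ofFn π =
      π ⟨0, by omega⟩ :: π ⟨1, by omega⟩ :: π ⟨2, by omega⟩ ::
        List.ofFn fun i : Fin m => π ⟨i + 3, by omega⟩ := by
    intro π
    rw [List.ofFn_succ, List.ofFn_succ, List.ofFn_succ]
    rfl
  have hT : ∀ a, (T a).card = m := by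
    intro a
    have : ({⟨a, by omega⟩, p, q} : Finset (Fin (m+3))).card = 3 := by
      rw [Finset.card_eq_three]
      refine ⟨_, _, _, ?_, ?_, ?_, rfl⟩ <;> simp only [p, q, ne_eq, Fin.ext_iff] <;> omega
    rw [Finset.card_sdiff_of_subset (Finset.subset_univ _), this]
    simp
  have key : ∀ x : (Σ a : Fin (m+1), AvS (T a)), ∃ π : Equiv.Perm (Fin (m+3)),
      List.ofFn π = ⟨x.1, by omega⟩ :: p :: q :: x.2.1 := by
    rintro ⟨a, R, h1, h2, h3⟩
    apply exists_perm
    · simp only [List.nodup_cons, List.mem_cons, h2, T, Finset.mem_sdiff, Finset.mem_insert,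
        Finset.mem_singleton, h1, p, q, Fin.ext_iff]
      simp
      omega
    · have : R.toFinset = T a := by ext x; simp [h2]
      have h4 := List.toFinset_card_of_nodup h1
      rw [this, hT] at h4
      simp [← h4]
  choose G hG using key
  let F : (Σ a : Fin (m+1), AvS (T a)) → {π : Equiv.Perm (Fin (m+3)) //
    π ⟨1, by omega⟩ = ⟨m+1, by omega⟩ ∧ π ⟨2, by omega⟩ = ⟨m+2, by omega⟩ ∧
      Av (List.ofFn fun i : Fin m => π ⟨i + 3, by omega⟩)} := fun x => ⟨G x, by
        have := hG x
        rw [hofn] at this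
        simp only [List.cons.injEq] at this
        refine ⟨this.2.1, this.2.2.1, ?_⟩
        rw [this.2.2.2]
        exact x.2.2.2.2⟩
  have hF : Function.Bijective F := by
    constructor
    · intro x y h
      have h : G x = G y := congrArg Subtype.val h
      have h' := hG x
      rw [h, hG y] at h'
      obtain ⟨a, R, hR⟩ := x
      obtain ⟨b, S, hS⟩ := y
      simp only [List.cons.injEq, true_and, Fin.mk.injEq] at h'
      obtain ⟨h4, h5⟩ := h'
      have h4 : b = a := Fin.ext h4
      subst h4 h5
      rfl
    · rintro ⟨π, e1, e2, hav⟩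
      have hnd : (List.ofFn π).Nodup := List.nodup_ofFn.2 π.injective
      have hmem : ∀ x, x ∈ List.ofFn π := fun x => by
        rw [List.mem_ofFn]; exact π.surjective x
      rw [hofn, e1, e2] at hnd hmem
      have ha : (π ⟨0, by omega⟩ : ℕ) < m + 1 := by
        simp only [List.nodup_cons, List.mem_cons, not_or, Fin.ext_iff] at hnd
        omega
      refine ⟨⟨⟨π ⟨0, by omega⟩, ha⟩, ⟨List.ofFn fun i : Fin m => π ⟨i + 3, by omega⟩,
        ?_, ?_, hav⟩⟩, ?_⟩
      · simp only [List.nodup_cons] at hnd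
        exact hnd.2.2.2
      · intro x
        have := hmem x
        simp only [List.nodup_cons] at hnd
        simp only [T, p, q, Finset.mem_sdiff, Finset.mem_univ, true_and, Finset.mem_insert,
          Finset.mem_singleton, Fin.eta]
        simp only [List.mem_cons] at this hnd
        grind
      · apply Subtype.ext
        apply Equiv.coe_fn_injective
        apply List.ofFn_injective
        change List.ofFn (G _) = _
        rw [hG, hofn π, e1, e2]
  rw [← Nat.card_eq_of_bijective F hF, Nat.card_sigma]
  simp [card_avS, hT]

theorem one_occurrence_12d3_begin123_count (n : ℕ) (hn : 3 ≤ n) :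
    Nat.card {π : Equiv.Perm (Fin n) //
      (∃! p : Fin n × Fin n, ∃ h : (p.1 : ℕ) + 1 < (p.2 : ℕ),
        π p.1 < π ⟨(p.1 : ℕ) + 1, Nat.lt_trans h p.2.isLt⟩ ∧
          π ⟨(p.1 : ℕ) + 1, Nat.lt_trans h p.2.isLt⟩ < π p.2) ∧
      BeginsInc123 π}
      = (n - 2) * bell (n - 3) := by
  obtain ⟨m, rfl⟩ : ∃ m, n = m + 3 := ⟨n - 3, by omega⟩
  rw [Nat.card_congr (Equiv.subtypeEquivRight (cond_iff m)), main_count]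
  have : m + 3 - 2 = m + 1 := by omega
  rw [this, Nat.add_sub_cancel, bell, card_finpartition]
  simp
end
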